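/- Counting DF-free digraphs: Let F be a graph with chromatic number r ≥ 2 and let DF be the digraph obtained from F by replacing each edge with a directed edge in each direction. Then the number of digraphs on [n] containing no copy of DF is 3^{(1/(r−1))·C(n,2)} · 4^{(1 − 1/(r−1))·C(n,2) + o(n²)}; equivalently, for every ε > 0 there exists n₀ such that for all n ≥ n₀, the base-4 logarithm of this number differs from ((1 − 1/(r−1)) + (1/(r−1))·log₄3)·C(n,2) by at most ε·n². -/

import Mathlib

open Filter

/-- The edges of the complete graph `K_n`: ordered pairs `(i, j)` with `i < j`. -/
abbrev Edge (n : ℕ) := {p : Fin n × Fin n // p.1 < p.2}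

/-- A digraph on `[n]`, encoded as a 4-colouring of `E(K_n)`: each pair `{i,j}` with
`i < j` records whether the directed edge `i → j` is present (first component) and
whether `j → i` is present (second component). -/
abbrev DiColouring (n : ℕ) := Edge n → Bool × Bool

/-- A digraph template: a nonempty palette of the 4 possible states at each pair. -/
abbrev DiTemplate (n : ℕ) := Edge n → Finset (Bool × Bool)

def DProper {n : ℕ} (t : DiTemplate n) : Prop := ∀ e, (t e).Nonempty

def DRealises {n : ℕ} (c : DiColouring n) (t : DiTemplate n) : Prop := ∀ e, c e ∈ t e

/-- The entropy (base 4) of a digraph template. -/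
noncomputable def DEnt {n : ℕ} (t : DiTemplate n) : ℝ :=
  ∑ e : Edge n, Real.logb 4 ((t e).card)

/-- The digraph encoded by `c` has a double edge between `u` and `v`. -/
def HasDoubleEdge {n : ℕ} (c : DiColouring n) (u v : Fin n) : Prop :=
  ∃ e : Edge n, ((e.1.1 = u ∧ e.1.2 = v) ∨ (e.1.1 = v ∧ e.1.2 = u)) ∧ c e = (true, true)

/-- The digraph encoded by `c` contains a copy of `DF`, the digraph obtained from the
graph `F` by replacing every edge by a directed edge in each direction. -/
def ContainsDF {m n : ℕ} (F : SimpleGraph (Fin m)) (c : DiColouring n) : Prop :=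
  ∃ ψ : Fin m ↪ Fin n, ∀ i j : Fin m, F.Adj i j → HasDoubleEdge c (ψ i) (ψ j)

/-- `G` contains a subgraph isomorphic to `F`. -/
def ContainsSub {m n : ℕ} (F : SimpleGraph (Fin m)) (G : SimpleGraph (Fin n)) : Prop :=
  ∃ ψ : Fin m ↪ Fin n, ∀ i j : Fin m, F.Adj i j → G.Adj (ψ i) (ψ j)

/-- The Turán number `ex(n, F)`: the maximum number of edges of an `F`-free graph
on `n` vertices. -/
noncomputable def turan {m : ℕ} (F : SimpleGraph (Fin m)) (n : ℕ) : ℕ :=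
  sSup {x | ∃ G : SimpleGraph (Fin n), ¬ ContainsSub F G ∧ G.edgeSet.ncard = x}

/-- The extremal entropy `ex(n, P)` for the property `P` of `DF`-free digraphs. -/
noncomputable def exEntDF {m : ℕ} (F : SimpleGraph (Fin m)) (n : ℕ) : ℝ :=
  sSup {x | ∃ t : DiTemplate n, DProper t ∧
    (∀ c : DiColouring n, DRealises c t → ¬ ContainsDF F c) ∧ DEnt t = x}


open Finset Classical in
/-- Embedding lemma: a system of pairwise regular dense parts contains every graph with a
proper colouring by the parts. -/
lemma embed_aux {m n r : ℕ} (F : SimpleGraph (Fin m)) (c : Fin m → Fin r)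
    (hc : ∀ i j, F.Adj i j → c i ≠ c j) (G : SimpleGraph (Fin n)) [DecidableRel G.Adj]
    (V : Fin r → Finset (Fin n)) (η d : ℝ) (hη : 0 < η) (hηd : η ≤ d / 2) (hd1 : d ≤ 1)
    (hun : ∀ i j, i ≠ j → G.IsUniform η (V i) (V j))
    (hden : ∀ i j, i ≠ j → d ≤ (G.edgeDensity (V i) (V j) : ℝ))
    (hηm : η ≤ (d / 2) ^ m)
    (hsize : ∀ i, (m : ℝ) * (η * #(V i) + 1) < (d / 2) ^ m * #(V i)) (S : Finset (Fin m)) :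
    ∃ f : Fin m → Fin n, Set.InjOn f S ∧ (∀ v ∈ S, ∀ w ∈ S, F.Adj v w → G.Adj (f v) (f w)) ∧
      ∀ w, w ∉ S → (d / 2) ^ #S * #(V (c w)) ≤
        #{x ∈ V (c w) | ∀ v ∈ S, F.Adj v w → G.Adj (f v) x} := by
  classical
  have hδ0 : 0 < d / 2 := hη.trans_le hηd
  have hδ1 : d / 2 ≤ 1 := by linarith
  induction S using Finset.induction_on with
  | empty =>
    by_cases hm : m = 0
    · subst hm
      exact ⟨fun i => i.elim0, by simp, by simp, fun w => w.elim0⟩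
    · have i : Fin m := ⟨0, by omega⟩
      have : (V (c i)).Nonempty := by
        rw [nonempty_iff_ne_empty]
        intro h
        have := hsize (c i)
        rw [h] at this
        simp at this
        linarith [(Nat.cast_nonneg m : (0 : ℝ) ≤ m)]
      exact ⟨fun _ => this.choose, by simp, by simp, by simp⟩
  | insert a S ha ih =>
    obtain ⟨f, hinj, hadj, hcand⟩ := ih
    set C : Fin m → Finset (Fin n) :=
      fun w => {x ∈ V (c w) | ∀ v ∈ S, F.Adj v w → G.Adj (f v) x} with hC
    have hSm : #S ≤ m := by simpa using card_le_univ S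
    have hpow : (d / 2) ^ m ≤ (d / 2) ^ #S := pow_le_pow_of_le_one hδ0.le hδ1 hSm
    set W : Finset (Fin m) := {w | w ∉ S ∧ F.Adj a w} with hW
    set B : Fin m → Finset (Fin n) :=
      fun w => {x ∈ C a | (#{y ∈ C w | G.Adj x y} : ℝ) < d / 2 * #(C w)} with hB
    have hBcard : ∀ w ∈ W, (#(B w) : ℝ) ≤ η * #(V (c a)) := by
      intro w hw
      simp only [hW, mem_filter, mem_univ, true_and] at hw
      by_contra! hlt
      have hne := hc a w hw.2
      have h1 := hun _ _ hne (s' := B w) ((filter_subset _ _).trans (filter_subset _ _))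
        (t' := C w) (filter_subset _ _) (by linarith)
        (by
          have := hcand w hw.1
          have h2 : η * (#(V (c w)) : ℝ) ≤ (d / 2) ^ #S * #(V (c w)) := by
            gcongr; exact hηm.trans hpow
          rw [mul_comm]; exact h2.trans this)
      have h2 := hden _ _ hne
      have h3 : d / 2 < (G.edgeDensity (B w) (C w) : ℝ) := by
        have := (abs_lt.1 h1).1
        linarith
      have h4 : (#(G.interedges (B w) (C w)) : ℝ) ≤ d / 2 * (#(B w) * #(C w)) := by
        have : #(G.interedges (B w) (C w)) = ∑ x ∈ B w, #{y ∈ C w | G.Adj x y} := by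
          unfold SimpleGraph.interedges Rel.interedges
          rw [card_filter, sum_product]
          simp only [card_filter]
        rw [this]
        push_cast
        calc _ ≤ ∑ x ∈ B w, d / 2 * (#(C w) : ℝ) := by
              apply sum_le_sum
              intro x hx
              exact (mem_filter.1 hx).2.le
          _ = _ := by rw [sum_const, nsmul_eq_mul]; ring
      rw [SimpleGraph.edgeDensity_def] at h3
      push_cast at h3
      have h5 : (0 : ℝ) ≤ #(B w) * #(C w) := by positivity
      exact absurd (div_le_of_le_mul₀ h5 hδ0.le h4) (not_le.2 h3)
    have hex : ∃ x ∈ C a, x ∉ W.biUnion B ∪ S.image f := by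
      by_contra! hcon
      have h1 : #(C a) ≤ #(W.biUnion B ∪ S.image f) := card_le_card hcon
      have h2 : #(W.biUnion B ∪ S.image f) ≤ ∑ w ∈ W, #(B w) + #S :=
        (card_union_le _ _).trans (add_le_add card_biUnion_le card_image_le)
      have h3 : (∑ w ∈ W, (#(B w) : ℝ)) ≤ m * (η * #(V (c a))) := by
        calc _ ≤ ∑ w ∈ W, η * (#(V (c a)) : ℝ) := sum_le_sum hBcard
          _ = #W * (η * (#(V (c a)) : ℝ)) := by rw [sum_const, nsmul_eq_mul]
          _ ≤ _ := by
            gcongr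
            simpa using card_le_univ W
      have h4 : (#(C a) : ℝ) ≤ ∑ w ∈ W, (#(B w) : ℝ) + #S := by exact_mod_cast h1.trans h2
      have h5 := hcand a ha
      have h6 : (d / 2) ^ m * (#(V (c a)) : ℝ) ≤ (d / 2) ^ #S * #(V (c a)) := by gcongr
      have h7 := hsize (c a)
      have h8 : (#S : ℝ) ≤ m := by exact_mod_cast hSm
      have h9 : (d / 2) ^ #S * (#(V (c a)) : ℝ) ≤ #(C a) := h5
      nlinarith
    obtain ⟨x, hxC, hx⟩ := hex
    simp only [mem_union, mem_biUnion, mem_image, not_or, not_exists, not_and] at hx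
    obtain ⟨hxB, hxS⟩ := hx
    have hxC' := (mem_filter.1 hxC).2
    have hupd : ∀ v ∈ S, Function.update f a x v = f v := by
      intro v hv
      rw [Function.update_of_ne]
      rintro rfl
      exact ha hv
    refine ⟨Function.update f a x, ?_, ?_, ?_⟩
    · intro v hv w hw hvw
      simp only [coe_insert, Set.mem_insert_iff, mem_coe] at hv hw
      rcases hv with rfl | hv <;> rcases hw with rfl | hw
      · rfl
      · rw [hupd _ hw, Function.update_self] at hvw
        exact absurd hvw.symm (hxS w hw)
      · rw [hupd _ hv, Function.update_self] at hvw
        exact absurd hvw (hxS v hv)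
      · rw [hupd _ hv, hupd _ hw] at hvw
        exact hinj hv hw hvw
    · intro v hv w hw hvw
      rw [mem_insert] at hv hw
      rcases hv with rfl | hv <;> rcases hw with rfl | hw
      · exact absurd rfl hvw.ne
      · rw [hupd _ hw, Function.update_self]
        exact (hxC' w hw hvw.symm).symm
      · rw [hupd _ hv, Function.update_self]
        exact hxC' v hv hvw
      · rw [hupd _ hv, hupd _ hw]
        exact hadj v hv w hw hvw
    · intro w hw
      rw [mem_insert, not_or] at hw
      obtain ⟨hwa, hwS⟩ := hw
      have hcw : (d / 2) ^ #S * (#(V (c w)) : ℝ) ≤ #(C w) := hcand w hwS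
      rw [card_insert_of_notMem ha, pow_succ]
      have hle : d / 2 * (#(C w) : ℝ) ≤ #{y ∈ V (c w) |
          ∀ v ∈ insert a S, F.Adj v w → G.Adj (Function.update f a x v) y} := by
        by_cases haw : F.Adj a w
        · have h1 : d / 2 * (#(C w) : ℝ) ≤ #{y ∈ C w | G.Adj x y} := by
            by_contra! h
            exact hxB w (by simp [hW, hwS, haw]) (mem_filter.2 ⟨hxC, h⟩)
          refine h1.trans ?_
          norm_cast
          apply card_le_card
          intro y hy
          simp only [hC, mem_filter] at hy ⊢
          refine ⟨hy.1.1, ?_⟩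
          intro v hv hvw
          rw [mem_insert] at hv
          rcases hv with rfl | hv
          · rw [Function.update_self]; exact hy.2
          · rw [hupd v hv]; exact hy.1.2 v hv hvw
        · have h1 : d / 2 * (#(C w) : ℝ) ≤ #(C w) := by
            have : (0 : ℝ) ≤ #(C w) := by positivity
            nlinarith
          refine h1.trans ?_
          norm_cast
          apply card_le_card
          intro y hy
          simp only [hC, mem_filter] at hy ⊢
          refine ⟨hy.1, ?_⟩
          intro v hv hvw
          rw [mem_insert] at hv
          rcases hv with rfl | hv
          · exact absurd hvw haw
          · rw [hupd v hv]; exact hy.2 v hv hvw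
      calc _ = d / 2 * ((d / 2) ^ #S * (#(V (c w)) : ℝ)) := by ring
        _ ≤ d / 2 * (#(C w) : ℝ) := by gcongr
        _ ≤ _ := hle

open Finset in
lemma embed {m n r : ℕ} (F : SimpleGraph (Fin m)) (c : Fin m → Fin r)
    (hc : ∀ i j, F.Adj i j → c i ≠ c j) (G : SimpleGraph (Fin n)) [DecidableRel G.Adj]
    (V : Fin r → Finset (Fin n)) (η d : ℝ) (hη : 0 < η) (hηd : η ≤ d / 2) (hd1 : d ≤ 1)
    (hun : ∀ i j, i ≠ j → G.IsUniform η (V i) (V j))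
    (hden : ∀ i j, i ≠ j → d ≤ (G.edgeDensity (V i) (V j) : ℝ))
    (hηm : η ≤ (d / 2) ^ m)
    (hsize : ∀ i, (m : ℝ) * (η * #(V i) + 1) < (d / 2) ^ m * #(V i)) :
    ContainsSub F G := by
  obtain ⟨f, h1, h2, -⟩ := embed_aux F c hc G V η d hη hηd hd1 hun hden hηm hsize univ
  exact ⟨⟨f, fun a b hab => h1 (by simp) (by simp) hab⟩, fun i j hij => h2 i (by simp) j (by simp) hij⟩

open Finset Classical in
/-- Every `F`-free graph is, up to few edges, contained in a clique-free blow-up of a bounded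
graph. -/
lemma template {m r : ℕ} (F : SimpleGraph (Fin m)) (hF : F.Colorable r) (ε : ℝ) (hε : 0 < ε) :
    ∃ M n₀ : ℕ, 0 < M ∧ ∀ n, n₀ ≤ n → ∀ G : SimpleGraph (Fin n), ¬ ContainsSub F G →
      ∃ (p : Fin n → Fin M) (H : SimpleGraph (Fin M)), (H.comap p).CliqueFree r ∧
        (#{xy : Fin n × Fin n | G.Adj xy.1 xy.2 ∧ ¬ (H.comap p).Adj xy.1 xy.2} : ℝ)
          ≤ ε * (n : ℝ) ^ 2 := by
  obtain ⟨col⟩ := hF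
  set e := min ε 1 with he
  have he0 : 0 < e := lt_min hε one_pos
  have he1 : e ≤ 1 := min_le_right _ _
  have heε : e ≤ ε := min_le_left _ _
  set d := e / 16 with hd
  have hd0 : 0 < d := by positivity
  have hd1 : d ≤ 1 := by linarith
  set η := min (d / 2) ((d / 2) ^ m / (2 * (m + 1))) with hηdef
  have hη : 0 < η := lt_min (by positivity) (by positivity)
  have hηd : η ≤ d / 2 := min_le_left _ _
  have hη2 : η ≤ (d / 2) ^ m / (2 * (m + 1)) := min_le_right _ _
  have hpm : 0 < (d / 2) ^ m := by positivity
  have hη3 : η * (2 * (m + 1)) ≤ (d / 2) ^ m := by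
    rwa [le_div_iff₀ (by positivity)] at hη2
  have hm0 : (0 : ℝ) ≤ m := Nat.cast_nonneg m
  have hηm : η ≤ (d / 2) ^ m := by nlinarith
  obtain ⟨s₀, hs₀⟩ := exists_nat_gt ((m : ℝ) / ((d / 2) ^ m / 2))
  set l := ⌈4 / e⌉₊ with hl
  set M := SzemerediRegularity.bound η l with hM
  have hMpos : 0 < M := SzemerediRegularity.bound_pos ..
  refine ⟨M, l + M * (s₀ + 1) + 1, hMpos, ?_⟩
  intro n hn G hG
  have hln : l ≤ Fintype.card (Fin n) := by
    rw [Fintype.card_fin]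
    have := Nat.zero_le (M * (s₀ + 1))
    omega
  have hne : Nonempty (Fin n) := ⟨⟨0, by omega⟩⟩
  obtain ⟨P, hP1, hP2, hP3, hP4⟩ := szemeredi_regularity G hη hln
  have hl' : 4 / e ≤ (#P.parts : ℝ) := (Nat.le_ceil _).trans (by exact_mod_cast hP2)
  have hPpos : 0 < #P.parts := by
    have : (0 : ℝ) < #P.parts := lt_of_lt_of_le (by positivity) hl'
    exact_mod_cast this
  have hsz : ∀ U ∈ P.parts, s₀ + 1 ≤ #U := by
    intro U hU
    have h1 := hP1.average_le_card_part hU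
    refine le_trans ?_ h1
    rw [Nat.le_div_iff_mul_le hPpos]
    calc (s₀ + 1) * #P.parts ≤ (s₀ + 1) * M := Nat.mul_le_mul_left _ hP3
      _ = M * (s₀ + 1) := mul_comm _ _
      _ ≤ _ := by simp only [card_univ, Fintype.card_fin]; omega
  obtain ⟨g⟩ : Nonempty (P.parts ↪ Fin M) := by
    apply Function.Embedding.nonempty_of_card_le
    simpa using hP3
  have hpart : ∀ x : Fin n, ∃ U : P.parts, x ∈ U.1 := by
    intro x
    obtain ⟨U, hU, hx⟩ := P.exists_mem (mem_univ x)
    exact ⟨⟨U, hU⟩, hx⟩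
  choose q hq using hpart
  let H₀ : SimpleGraph P.parts :=
    { Adj := fun U V => U ≠ V ∧ G.IsUniform η U.1 V.1 ∧ d ≤ (G.edgeDensity U.1 V.1 : ℝ)
      symm := ⟨by
        rintro U V ⟨h1, h2, h3⟩
        refine ⟨h1.symm, h2.symm, ?_⟩
        rwa [SimpleGraph.edgeDensity_comm]⟩
      loopless := ⟨fun U h => h.1 rfl⟩ }
  have hT : ∀ x y, ((H₀.map g).comap (g ∘ q)).Adj x y ↔ H₀.Adj (q x) (q y) := by
    intro x y
    simp
  refine ⟨g ∘ q, H₀.map g, ?_, ?_⟩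
  · by_contra hcl
    rw [SimpleGraph.not_cliqueFree_iff_top_isContained] at hcl
    obtain ⟨φ⟩ := hcl
    have hφ : ∀ i j, i ≠ j → H₀.Adj (q (φ i)) (q (φ j)) := by
      intro i j hij
      rw [← hT]
      exact φ.toHom.map_adj (by simpa using hij)
    apply hG
    refine embed F col (fun i j h => col.valid h) G (fun i => (q (φ i)).1) η d hη hηd hd1
      (fun i j hij => (hφ i j hij).2.1) (fun i j hij => (hφ i j hij).2.2) hηm ?_
    intro i
    have h1 : ((s₀ : ℝ) + 1) ≤ #(q (φ i)).1 := by exact_mod_cast hsz _ (q (φ i)).2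
    have h2 : (m : ℝ) < (d / 2) ^ m / 2 * #(q (φ i)).1 := by
      rw [div_lt_iff₀ (by positivity)] at hs₀
      nlinarith
    have h3 : (0 : ℝ) ≤ #(q (φ i)).1 := by positivity
    have h4 : η * (m : ℝ) ≤ (d / 2) ^ m / 2 := by nlinarith
    nlinarith [mul_le_mul_of_nonneg_right h4 h3]
  · let A := (P.nonUniforms G η).biUnion fun (U, V) ↦ U ×ˢ V
    let B := P.parts.biUnion offDiag
    let C := (P.sparsePairs G d).biUnion fun (U, V) ↦ G.interedges U V
    have hsub : ({xy : Fin n × Fin n | G.Adj xy.1 xy.2 ∧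
        ¬ ((H₀.map g).comap (g ∘ q)).Adj xy.1 xy.2} : Finset _) ⊆ A ∪ B ∪ C := by
      rintro ⟨x, y⟩ hxy
      rw [mem_filter] at hxy
      obtain ⟨-, h1, h2⟩ := hxy
      rw [hT] at h2
      simp only at h1 h2
      simp only [A, B, C, mem_union, mem_biUnion, Prod.exists, mem_product, mem_offDiag,
        P.mk_mem_nonUniforms, Finpartition.mk_mem_sparsePairs, SimpleGraph.mem_interedges_iff]
      by_cases h3 : q x = q y
      · left; right
        exact ⟨(q x).1, (q x).2, hq x, h3 ▸ hq y, h1.ne⟩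
      have h3' : (q x).1 ≠ (q y).1 := fun h => h3 (Subtype.ext h)
      by_cases h4 : G.IsUniform η (q x).1 (q y).1
      · right
        refine ⟨(q x).1, (q y).1, ⟨(q x).2, (q y).2, h3', ?_⟩, hq x, hq y, h1⟩
        by_contra! h5
        exact h2 ⟨h3, h4, h5⟩
      · left; left
        exact ⟨(q x).1, (q y).1, ⟨(q x).2, (q y).2, h3', h4⟩, hq x, hq y⟩
    have hA : (#A : ℝ) ≤ 4 * η * (n : ℝ) ^ 2 := by
      have := (hP1.sum_nonUniforms_lt univ_nonempty hη hP4).le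
      simpa using this
    have hB : (#B : ℝ) ≤ e / 2 * (n : ℝ) ^ 2 := by
      have := hP1.card_biUnion_offDiag_le he0 hl'
      simpa using this
    have hC : (#C : ℝ) ≤ 4 * d * (n : ℝ) ^ 2 := by
      have := hP1.card_interedges_sparsePairs_le (G := G) (ε := d) hd0.le
      simpa using this
    have h1 : (#(A ∪ B ∪ C) : ℝ) ≤ #A + #B + #C := by
      exact_mod_cast (card_union_le _ _).trans (Nat.add_le_add_right (card_union_le _ _) _)
    have h2 := card_le_card hsub
    have h3 : (#({xy : Fin n × Fin n | G.Adj xy.1 xy.2 ∧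
        ¬ ((H₀.map g).comap (g ∘ q)).Adj xy.1 xy.2} : Finset _) : ℝ) ≤ #(A ∪ B ∪ C) := by
      exact_mod_cast h2
    refine le_trans (le_of_eq (by congr!)) (h3.trans (h1.trans ?_))
    have hn2 : (0 : ℝ) ≤ (n : ℝ) ^ 2 := by positivity
    have : 4 * η + e / 2 + 4 * d ≤ ε := by linarith
    nlinarith [mul_le_mul_of_nonneg_right this hn2]

open Finset Classical in
lemma edge_card {n : ℕ} (T : SimpleGraph (Fin n)) :
    #{e : Edge n | T.Adj e.1.1 e.1.2} = #T.edgeFinset := by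
  apply card_bij (fun e _ => s(e.1.1, e.1.2))
  · intro e he
    simpa using he
  · rintro ⟨⟨a, b⟩, hab⟩ _ ⟨⟨c, d⟩, hcd⟩ _ h
    simp only [Sym2.eq_iff] at h
    simp only at hab hcd
    rcases h with ⟨rfl, rfl⟩ | ⟨rfl, rfl⟩
    · rfl
    · exact absurd hab (not_lt.2 hcd.le)
  · intro b hb
    induction b using Sym2.ind with
    | _ x y =>
      rw [SimpleGraph.mem_edgeFinset, SimpleGraph.mem_edgeSet] at hb
      rcases lt_or_gt_of_ne hb.ne with h | h
      · exact ⟨⟨(x, y), h⟩, by simpa using hb, rfl⟩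
      · exact ⟨⟨(y, x), h⟩, by simpa using hb.symm, Sym2.eq_swap⟩

open Finset Classical in
lemma edge_total (n : ℕ) : Fintype.card (Edge n) = n.choose 2 := by
  have h := edge_card (⊤ : SimpleGraph (Fin n))
  have h2 := SimpleGraph.card_edgeFinset_top_eq_card_choose_two (V := Fin n)
  rw [Fintype.card_fin] at h2
  have h3 : #{e : Edge n | (⊤ : SimpleGraph (Fin n)).Adj e.1.1 e.1.2} = Fintype.card (Edge n) := by
    rw [filter_true_of_mem, card_univ]
    intro e _
    simpa using e.2.ne
  refine h3.symm.trans (Eq.trans ?_ (h.trans (Eq.trans ?_ h2))) <;> congr!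

open Finset Classical in
lemma small_sets {α : Type*} [Fintype α] (x : ℝ) (hx : 0 < x) (hx1 : x ≤ 1) (k : ℕ) :
    (#{R : Finset α | #R ≤ k} : ℝ) * x ^ k ≤ (1 + x) ^ Fintype.card α := by
  rw [add_comm, ← Fintype.sum_pow_mul_eq_add_pow]
  calc (#{R : Finset α | #R ≤ k} : ℝ) * x ^ k
      = ∑ R ∈ ({R : Finset α | #R ≤ k} : Finset (Finset α)), x ^ k := by
        rw [sum_const, nsmul_eq_mul]
    _ ≤ ∑ R ∈ ({R : Finset α | #R ≤ k} : Finset (Finset α)), x ^ #R := by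
        apply sum_le_sum
        intro R hR
        exact pow_le_pow_of_le_one hx.le hx1 (mem_filter.1 hR).2
    _ ≤ ∑ R : Finset α, x ^ #R :=
        sum_le_sum_of_subset_of_nonneg (filter_subset _ _) (fun _ _ _ => by positivity)
    _ = _ := by simp

open Finset Classical in
lemma family_card_le {n : ℕ} (T : SimpleGraph (Fin n)) (Q : Edge n → Finset (Bool × Bool))
    (h4 : ∀ e, #(Q e) ≤ 4) (h3 : ∀ e : Edge n, ¬ T.Adj e.1.1 e.1.2 → #(Q e) ≤ 3) :
    #(Fintype.piFinset Q) ≤ 4 ^ #T.edgeFinset * 3 ^ (n.choose 2 - #T.edgeFinset) := by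
  rw [Fintype.card_piFinset]
  calc ∏ e, #(Q e) ≤ ∏ e : Edge n, (if T.Adj e.1.1 e.1.2 then 4 else 3) := by
        apply prod_le_prod'
        intro e _
        split_ifs with h
        · exact h4 e
        · exact h3 e h
    _ = _ := by
        rw [prod_ite, prod_const, prod_const, edge_card, filter_not, card_sdiff_of_subset
          (filter_subset _ _), edge_card, card_univ, edge_total]

open Finset Classical in
lemma le_family_card {n : ℕ} (T : SimpleGraph (Fin n)) (Q : Edge n → Finset (Bool × Bool))
    (h4 : ∀ e : Edge n, T.Adj e.1.1 e.1.2 → 4 ≤ #(Q e)) (h3 : ∀ e : Edge n, 3 ≤ #(Q e)) :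
    4 ^ #T.edgeFinset * 3 ^ (n.choose 2 - #T.edgeFinset) ≤ #(Fintype.piFinset Q) := by
  rw [Fintype.card_piFinset]
  calc _ = ∏ e : Edge n, (if T.Adj e.1.1 e.1.2 then 4 else 3) := by
        rw [prod_ite, prod_const, prod_const, edge_card, filter_not, card_sdiff_of_subset
          (filter_subset _ _), edge_card, card_univ, edge_total]
    _ ≤ _ := by
        apply prod_le_prod'
        intro e _
        split_ifs with h
        · exact h4 e h
        · exact h3 e

/-- The graph of double edges. -/
def dbl {n : ℕ} (c : DiColouring n) : SimpleGraph (Fin n) where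
  Adj u v := HasDoubleEdge c u v
  symm := ⟨by
    rintro u v ⟨e, h, h'⟩
    exact ⟨e, h.symm, h'⟩⟩
  loopless := ⟨by
    rintro u ⟨e, h, -⟩
    have := e.2.ne
    rcases h with ⟨h1, h2⟩ | ⟨h1, h2⟩ <;> exact this (h1.trans h2.symm)⟩

lemma dbl_adj_edge {n : ℕ} (c : DiColouring n) (e : Edge n) :
    (dbl c).Adj e.1.1 e.1.2 ↔ c e = (true, true) := by
  constructor
  · rintro ⟨e', h, h'⟩
    rcases h with ⟨h1, h2⟩ | ⟨h1, h2⟩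
    · have : e' = e := Subtype.ext (Prod.ext h1 h2)
      rwa [← this]
    · have h3 := e.2
      have h4 := e'.2
      rw [h1, h2] at h4
      exact absurd h3 (not_lt.2 h4.le)
  · intro h
    exact ⟨e, Or.inl ⟨rfl, rfl⟩, h⟩

lemma contains_iff {m n : ℕ} (F : SimpleGraph (Fin m)) (c : DiColouring n) :
    ContainsDF F c ↔ ContainsSub F (dbl c) := Iff.rfl

open Finset Classical in
/-- Lower bound on the count. -/
lemma count_lower {m : ℕ} (F : SimpleGraph (Fin m)) (r n : ℕ) (hr : 2 ≤ r)
    (hF : ¬ F.Colorable (r - 1)) :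
    4 ^ #(SimpleGraph.turanGraph n (r - 1)).edgeFinset *
      3 ^ (n.choose 2 - #(SimpleGraph.turanGraph n (r - 1)).edgeFinset) ≤
    ({c : DiColouring n | ¬ ContainsDF F c}).ncard := by
  set T := SimpleGraph.turanGraph n (r - 1) with hT
  refine le_trans (le_trans (le_of_eq (by congr!)) (le_family_card T (fun e => if T.Adj e.1.1 e.1.2 then univ else
    univ.erase (true, true)) ?_ ?_)) ?_
  · intro e he
    simp [he]
  · intro e
    split_ifs <;> simp
  · rw [← Set.ncard_coe_finset]
    apply Set.ncard_le_ncard _ (Set.toFinite _)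
    intro c hc
    rw [mem_coe, Fintype.mem_piFinset] at hc
    rintro ⟨ψ, hψ⟩
    apply hF
    refine ⟨SimpleGraph.Coloring.mk (fun i => (⟨(ψ i : ℕ) % (r - 1),
      Nat.mod_lt _ (by omega)⟩ : Fin (r - 1))) ?_⟩
    intro i j hij h
    simp only [Fin.mk.injEq] at h
    obtain ⟨e, he, hce⟩ := hψ i j hij
    have h2 := hc e
    have h3 : ¬ T.Adj e.1.1 e.1.2 := by
      rw [hT, SimpleGraph.turanGraph_adj]
      rcases he with ⟨h4, h5⟩ | ⟨h4, h5⟩ <;> rw [h4, h5, h] <;> simp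
    simp [h3, hce] at h2

open Finset Classical in
/-- Upper bound on the count. -/
lemma count_upper {m r : ℕ} (hr : 2 ≤ r) (F : SimpleGraph (Fin m)) (hF : F.Colorable r)
    (ε : ℝ) (hε : 0 < ε) :
    ∃ M n₀ K : ℕ, 0 < M ∧ 0 < K ∧ ∀ n, n₀ ≤ n → ∃ a : ℕ, a ≤ n.choose 2 ∧
      2 * (r - 1) * a ≤ (r - 1 - 1) * n ^ 2 ∧
      ({c : DiColouring n | ¬ ContainsDF F c}).ncard ≤
        M ^ n * K * #{R : Finset (Edge n) | #R ≤ ⌊ε * (n : ℝ) ^ 2⌋₊} *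
          (4 ^ a * 3 ^ (n.choose 2 - a)) := by
  obtain ⟨M, n₀, hM, h⟩ := template F hF ε hε
  refine ⟨M, n₀, Fintype.card (SimpleGraph (Fin M)), hM, Fintype.card_pos, ?_⟩
  intro n hn
  set a := #(SimpleGraph.turanGraph n (r - 1)).edgeFinset with ha
  have ha1 : a ≤ n.choose 2 := by
    have := (SimpleGraph.turanGraph n (r - 1)).card_edgeFinset_le_card_choose_two
    rwa [Fintype.card_fin] at this
  refine ⟨a, ha1, SimpleGraph.mul_card_edgeFinset_turanGraph_le, ?_⟩
  set k := ⌊ε * (n : ℝ) ^ 2⌋₊ with hk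
  set I : Finset ((Fin n → Fin M) × SimpleGraph (Fin M)) :=
    {pH | (pH.2.comap pH.1).CliqueFree r} with hI
  set J : Finset (Finset (Edge n)) := {R | #R ≤ k} with hJ
  set Q : ((Fin n → Fin M) × SimpleGraph (Fin M)) × Finset (Edge n) →
      Edge n → Finset (Bool × Bool) := fun z e =>
    if (z.1.2.comap z.1.1).Adj e.1.1 e.1.2 then univ else
      if e ∈ z.2 then {(true, true)} else univ.erase (true, true) with hQ
  have hsub : {c : DiColouring n | ¬ ContainsDF F c} ⊆
      (((I ×ˢ J).biUnion fun z => Fintype.piFinset (Q z) : Finset (DiColouring n)) :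
        Set (DiColouring n)) := by
    intro c hc
    obtain ⟨p, H, h1, h2⟩ := h n hn (dbl c) hc
    set T := H.comap p with hT
    set R : Finset (Edge n) := {e | c e = (true, true) ∧ ¬ T.Adj e.1.1 e.1.2} with hR
    rw [mem_coe, mem_biUnion]
    refine ⟨((p, H), R), ?_, ?_⟩
    · rw [mem_product]
      refine ⟨by simpa [hI] using h1, ?_⟩
      rw [hJ, mem_filter]
      refine ⟨mem_univ _, ?_⟩
      apply Nat.le_floor
      refine le_trans ?_ h2
      norm_cast
      apply card_le_card_of_injOn (fun e => e.1)
      · intro e he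
        simp only [hR, coe_filter, mem_univ, true_and, Set.mem_ofPred_eq] at he ⊢
        rw [dbl_adj_edge]
        exact he
      · intro e _ e' _ hee
        exact Subtype.ext hee
    · rw [Fintype.mem_piFinset]
      intro e
      simp only [hQ]
      by_cases hTe : T.Adj e.1.1 e.1.2
      · rw [if_pos (show (H.comap p).Adj _ _ from hTe)]; exact mem_univ _
      · rw [if_neg (show ¬ (H.comap p).Adj _ _ from hTe)]
        by_cases hce : c e = (true, true)
        · rw [if_pos (by simp only [hR, mem_filter, mem_univ, true_and]; exact ⟨hce, hTe⟩), hce]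
          simp
        · rw [if_neg (by simp only [hR, mem_filter, mem_univ, true_and]; exact fun h => hce h.1)]
          simp [hce]
  have hcard : ∀ z ∈ I ×ˢ J, #(Fintype.piFinset (Q z)) ≤ 4 ^ a * 3 ^ (n.choose 2 - a) := by
    intro z hz
    rw [mem_product] at hz
    have hcf := (mem_filter.1 hz.1).2
    set T := z.1.2.comap z.1.1 with hT
    refine (family_card_le T (Q z) ?_ ?_).trans ?_
    · intro e
      exact (card_le_univ _).trans (by simp)
    · intro e he
      simp only [hQ]
      rw [if_neg (show ¬ (z.1.2.comap z.1.1).Adj _ _ from he)]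
      split_ifs <;> simp
    · have hr1 : r = (r - 1) + 1 := by omega
      have key : ∀ b ≤ a, 4 ^ b * 3 ^ (n.choose 2 - b) ≤ 4 ^ a * 3 ^ (n.choose 2 - a) := by
        intro b hb
        obtain ⟨u, hu⟩ := Nat.exists_eq_add_of_le hb
        obtain ⟨v, hv⟩ := Nat.exists_eq_add_of_le ha1
        have e1 : n.choose 2 - b = u + v := by omega
        have e2 : n.choose 2 - a = v := by omega
        rw [e1, e2, hu, pow_add, pow_add]
        calc 4 ^ b * (3 ^ u * 3 ^ v) ≤ 4 ^ b * (4 ^ u * 3 ^ v) := by gcongr; norm_num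
          _ = _ := by ring
      apply key
      have := (SimpleGraph.isTuranMaximal_turanGraph (n := n) (show 0 < r - 1 by omega)).2
        (G' := T) (by rw [← hr1]; exact hcf)
      convert this
  calc ({c : DiColouring n | ¬ ContainsDF F c}).ncard
      ≤ _ := Set.ncard_le_ncard hsub (Set.toFinite _)
    _ = _ := Set.ncard_coe_finset _
    _ ≤ #(I ×ˢ J) * (4 ^ a * 3 ^ (n.choose 2 - a)) := card_biUnion_le_card_mul _ _ _ hcard
    _ ≤ _ := by
      rw [card_product]
      gcongr
      refine (card_le_univ _).trans ?_
      simp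

lemma choose_two_real (n : ℕ) : (n.choose 2 : ℝ) = (n : ℝ) ^ 2 / 2 - n / 2 := by
  rw [Nat.cast_choose_two]; ring

lemma logb_main (a N : ℕ) (h : a ≤ N) :
    Real.logb 4 ((4 ^ a * 3 ^ (N - a) : ℕ) : ℝ) =
      N * Real.logb 4 3 + a * (1 - Real.logb 4 3) := by
  push_cast
  rw [Real.logb_mul (by positivity) (by positivity), Real.logb_pow, Real.logb_pow,
    Real.logb_self_eq_one (by norm_num), Nat.cast_sub h]
  ring

lemma L_nonneg : 0 ≤ Real.logb 4 3 := Real.logb_nonneg (by norm_num) (by norm_num)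

lemma L_le_one : Real.logb 4 3 ≤ 1 := by
  have h : Real.logb 4 3 ≤ Real.logb 4 4 :=
    Real.logb_le_logb_of_le (by norm_num) (by norm_num) (by norm_num)
  rwa [Real.logb_self_eq_one (by norm_num)] at h

lemma logb_le_log {y : ℝ} (hy : 1 ≤ y) : Real.logb 4 y ≤ Real.log y := by
  have h4 : 1 ≤ Real.log 4 := by
    have h := Real.log_two_gt_d9
    have : Real.log 4 = 2 * Real.log 2 := by
      rw [show (4 : ℝ) = 2 ^ 2 by norm_num, Real.log_pow]; norm_num
    rw [this]; linarith
  exact div_le_self (Real.log_nonneg hy) h4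

open Finset in
lemma turan_lower (n k : ℕ) (hk : 0 < k) :
    (1 - 1 / (k : ℝ)) * (n.choose 2 : ℝ) - ((k : ℝ) ^ 2 + 1) ≤
      (#(SimpleGraph.turanGraph n k).edgeFinset : ℝ) := by
  rw [SimpleGraph.card_edgeFinset_turanGraph]
  set s := n % k with hs
  have hsk : s < k := Nat.mod_lt _ hk
  have hsn : s ≤ n := Nat.mod_le _ _
  have hk0 : (0 : ℝ) < k := by exact_mod_cast hk
  have hk1 : (1 : ℝ) ≤ k := by exact_mod_cast hk
  have h1 : ((n ^ 2 - s ^ 2) * (k - 1) : ℕ) <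
      (2 * k) * ((n ^ 2 - s ^ 2) * (k - 1) / (2 * k) + 1) := Nat.lt_mul_div_succ _ (by omega)
  set D := (n ^ 2 - s ^ 2) * (k - 1) / (2 * k) with hD
  have h2 : ((n : ℝ) ^ 2 - (s : ℝ) ^ 2) * ((k : ℝ) - 1) < 2 * k * ((D : ℝ) + 1) := by
    have h3 : (((n ^ 2 - s ^ 2) * (k - 1) : ℕ) : ℝ) < ((2 * k * (D + 1) : ℕ) : ℝ) := by
      exact_mod_cast h1
    rw [Nat.cast_mul, Nat.cast_sub (Nat.pow_le_pow_left hsn 2), Nat.cast_sub hk] at h3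
    push_cast at h3
    exact h3
  have hs' : (s : ℝ) ≤ k := by exact_mod_cast hsk.le
  have hs0 : (0 : ℝ) ≤ s := by positivity
  have h4 : (s : ℝ) ^ 2 ≤ (k : ℝ) ^ 2 := by gcongr
  have h5 : (1 - 1 / (k : ℝ)) * ((n : ℝ) ^ 2 - (s : ℝ) ^ 2) / 2 < (D : ℝ) + 1 := by
    have : (1 - 1 / (k : ℝ)) * ((n : ℝ) ^ 2 - (s : ℝ) ^ 2) / 2 =
        ((n : ℝ) ^ 2 - (s : ℝ) ^ 2) * ((k : ℝ) - 1) / (2 * k) := by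
      field_simp
    rw [this, div_lt_iff₀ (by positivity)]
    linarith
  have hq0 : 0 ≤ 1 - 1 / (k : ℝ) := by
    rw [sub_nonneg, div_le_one hk0]; exact hk1
  have hq1 : 1 - 1 / (k : ℝ) ≤ 1 := by
    have : 0 ≤ 1 / (k : ℝ) := by positivity
    linarith
  rw [choose_two_real]
  push_cast
  have h6 : (0 : ℝ) ≤ (s.choose 2 : ℝ) := by positivity
  have h7 : (1 - 1 / (k : ℝ)) * (s : ℝ) ^ 2 ≤ 1 * (k : ℝ) ^ 2 := by gcongr
  have h8 : 0 ≤ (1 - 1 / (k : ℝ)) * n := by positivity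
  have h9 : 0 ≤ (k : ℝ) ^ 2 := by positivity
  nlinarith

set_option maxHeartbeats 2000000 in
/-- Counting `DF`-free digraphs (Corollary 4.5): if `F` has chromatic number `r ≥ 2`,
then the number of `DF`-free digraphs on `[n]` is
`3^{(1/(r-1))·C(n,2)} · 4^{(1-1/(r-1))·C(n,2) + o(n²)}`. -/
theorem counting_DF_free {m : ℕ} (F : SimpleGraph (Fin m)) (r : ℕ) (hr : 2 ≤ r)
    (hchrom : F.chromaticNumber = r) (ε : ℝ) (hε : 0 < ε) :
    ∃ n₀ : ℕ, ∀ n, n₀ ≤ n →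
      |Real.logb 4 (({c : DiColouring n | ¬ ContainsDF F c}).ncard : ℝ) -
          ((1 - 1 / ((r : ℝ) - 1)) + (1 / ((r : ℝ) - 1)) * Real.logb 4 3) *
            (n.choose 2 : ℝ)| ≤ ε * (n : ℝ) ^ 2 := by
  set L := Real.logb 4 3 with hL
  have hL0 : 0 ≤ L := L_nonneg
  have hL1 : L ≤ 1 := L_le_one
  have hcol : F.Colorable r := SimpleGraph.chromaticNumber_le_iff_colorable.1 hchrom.le
  have hncol : ¬ F.Colorable (r - 1) := by
    intro h
    have h1 := SimpleGraph.chromaticNumber_le_iff_colorable.2 h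
    rw [hchrom] at h1
    have h2 : r ≤ r - 1 := by exact_mod_cast h1
    omega
  have hkr : ((r - 1 : ℕ) : ℝ) = (r : ℝ) - 1 := by
    rw [Nat.cast_sub (by omega)]; simp
  set k : ℕ := r - 1 with hk
  have hk0 : 0 < k := by omega
  rw [← hkr]
  have hkR : (0 : ℝ) < k := by exact_mod_cast hk0
  have hkR1 : (1 : ℝ) ≤ k := by exact_mod_cast hk0
  set q : ℝ := 1 / (k : ℝ) with hq
  have hq0 : 0 ≤ q := by positivity
  have hq1 : q ≤ 1 := by rw [hq, div_le_one hkR]; exact hkR1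
  set x : ℝ := min (ε / 4) 1 with hx
  have hx0 : 0 < x := lt_min (by positivity) one_pos
  have hx1 : x ≤ 1 := min_le_right _ _
  have hxε : x ≤ ε / 4 := min_le_left _ _
  set Y : ℝ := - Real.logb 4 x with hY
  have hY0 : 0 ≤ Y := by
    have := Real.logb_nonpos (b := 4) (by norm_num) hx0.le hx1
    linarith
  set ε' : ℝ := ε / (4 * (Y + 1)) with hε'
  have hε'0 : 0 < ε' := by positivity
  have hε'Y : ε' * Y ≤ ε / 4 := by
    have : ε' * (Y + 1) = ε / 4 := by rw [hε']; field_simp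
    nlinarith
  obtain ⟨M, n₁, K, hM, hK, hup⟩ := count_upper hr F hcol ε' hε'0
  set A := Real.logb 4 M with hA
  have hA0 : 0 ≤ A := Real.logb_nonneg (by norm_num) (by exact_mod_cast hM)
  set B := Real.logb 4 K with hB
  have hB0 : 0 ≤ B := Real.logb_nonneg (by norm_num) (by exact_mod_cast hK)
  obtain ⟨n₂, hn₂⟩ := exists_nat_gt (2 * (A + B + 1) / ε)
  obtain ⟨n₃, hn₃⟩ := exists_nat_gt (((k : ℝ) ^ 2 + 1) / ε)
  refine ⟨n₁ + n₂ + n₃ + 1, fun n hn => ?_⟩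
  have hnR : (1 : ℝ) ≤ n := by exact_mod_cast (by omega : 1 ≤ n)
  have hn2R : (n₂ : ℝ) ≤ n := by exact_mod_cast (by omega : n₂ ≤ n)
  have hn3R : (n₃ : ℝ) ≤ n := by exact_mod_cast (by omega : n₃ ≤ n)
  rw [div_lt_iff₀ hε] at hn₂ hn₃
  set Z := ({c : DiColouring n | ¬ ContainsDF F c}).ncard with hZ
  have hN := choose_two_real n
  have hlow := count_lower F r n hr hncol
  have hturan := turan_lower n k hk0
  have hturan_le : (SimpleGraph.turanGraph n k).edgeFinset.card ≤ n.choose 2 := by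
    have := (SimpleGraph.turanGraph n k).card_edgeFinset_le_card_choose_two
    rwa [Fintype.card_fin] at this
  have hZpos : 0 < Z := lt_of_lt_of_le (by positivity) hlow
  have hZR : (0 : ℝ) < Z := by exact_mod_cast hZpos
  rw [abs_le]
  constructor
  · have h1 : Real.logb 4 ((4 ^ (SimpleGraph.turanGraph n k).edgeFinset.card *
        3 ^ (n.choose 2 - (SimpleGraph.turanGraph n k).edgeFinset.card) : ℕ) : ℝ) ≤
        Real.logb 4 (Z : ℝ) := by
      apply Real.logb_le_logb_of_le (by norm_num)
      · exact_mod_cast (by positivity :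
          0 < 4 ^ (SimpleGraph.turanGraph n k).edgeFinset.card *
            3 ^ (n.choose 2 - (SimpleGraph.turanGraph n k).edgeFinset.card))
      · have h0 := hlow
        rw [← hZ] at h0
        exact_mod_cast h0
    rw [logb_main _ _ hturan_le] at h1
    rw [← hL] at h1
    have h2 := mul_le_mul_of_nonneg_right hturan (sub_nonneg.2 hL1)
    have h3 : ((k : ℝ) ^ 2 + 1) * (1 - L) ≤ (k : ℝ) ^ 2 + 1 := by
      have : 0 ≤ (k : ℝ) ^ 2 + 1 := by positivity
      nlinarith
    have h4 : (k : ℝ) ^ 2 + 1 ≤ ε * (n : ℝ) ^ 2 := by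
      have : (n₃ : ℝ) * ε ≤ n * n * ε := by gcongr; nlinarith
      nlinarith
    rw [← hq, sub_mul] at h2
    have h9 : ((1 - q) + q * L) * (n.choose 2 : ℝ) =
        n.choose 2 * L + (1 - q) * n.choose 2 * (1 - L) := by ring
    rw [h9]
    linarith
  · obtain ⟨a, ha1, ha2, ha3⟩ := hup n (by omega)
    rw [← hZ] at ha3
    set J := (Finset.univ.filter fun R : Finset (Edge n) => R.card ≤ ⌊ε' * (n : ℝ) ^ 2⌋₊).card
      with hJ
    have hJ' := small_sets (α := Edge n) x hx0 hx1 ⌊ε' * (n : ℝ) ^ 2⌋₊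
    rw [edge_total] at hJ'
    set kk := ⌊ε' * (n : ℝ) ^ 2⌋₊ with hkk
    have hkkle : (kk : ℝ) ≤ ε' * (n : ℝ) ^ 2 := Nat.floor_le (by positivity)
    have hJ2 : (J : ℝ) * x ^ kk ≤ (1 + x) ^ n.choose 2 := by
      refine le_trans (le_of_eq ?_) hJ'
      congr!
    have hJpos : 0 < J := by
      rw [hJ, Finset.card_pos]
      exact ⟨∅, by simp⟩
    have hJR : (0 : ℝ) < J := by exact_mod_cast hJpos
    have hMR : (0 : ℝ) < M := by exact_mod_cast hM
    have hKR : (0 : ℝ) < K := by exact_mod_cast hK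
    have hlogJ : Real.logb 4 J ≤ ε / 2 * (n : ℝ) ^ 2 := by
      have h1 := Real.logb_le_logb_of_le (b := 4) (by norm_num) (by positivity) hJ2
      rw [Real.logb_mul hJR.ne' (by positivity), Real.logb_pow, Real.logb_pow] at h1
      have h2 : Real.logb 4 (1 + x) ≤ x := by
        refine (logb_le_log (by linarith)).trans ?_
        have := Real.log_le_sub_one_of_pos (by linarith : 0 < 1 + x)
        linarith
      have h3 : (n.choose 2 : ℝ) * Real.logb 4 (1 + x) ≤ (n : ℝ) ^ 2 * (ε / 4) := by
        have h20 : 0 ≤ Real.logb 4 (1 + x) := Real.logb_nonneg (by norm_num) (by linarith)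
        have : (n.choose 2 : ℝ) ≤ (n : ℝ) ^ 2 := by rw [hN]; nlinarith
        gcongr
        linarith
      have h4 : (kk : ℝ) * Y ≤ ε / 4 * (n : ℝ) ^ 2 := by
        calc (kk : ℝ) * Y ≤ ε' * (n : ℝ) ^ 2 * Y := by gcongr
          _ = ε' * Y * (n : ℝ) ^ 2 := by ring
          _ ≤ _ := by gcongr
      have h5 : (kk : ℝ) * Real.logb 4 x = - (kk * Y) := by rw [hY]; ring
      rw [h5] at h1
      linarith
    have h1 : Real.logb 4 (Z : ℝ) ≤ n * A + B + Real.logb 4 J +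
        (n.choose 2 * L + a * (1 - L)) := by
      have h2 : (Z : ℝ) ≤ (M : ℝ) ^ n * K * J * ((4 ^ a * 3 ^ (n.choose 2 - a) : ℕ) : ℝ) := by
        have h20 : Z ≤ M ^ n * K * J * (4 ^ a * 3 ^ (n.choose 2 - a)) := by
          refine ha3.trans (le_of_eq ?_)
          congr!
        exact_mod_cast h20
      have hpos : (0 : ℝ) < ((4 ^ a * 3 ^ (n.choose 2 - a) : ℕ) : ℝ) := by
        exact_mod_cast (by positivity : 0 < 4 ^ a * 3 ^ (n.choose 2 - a))
      refine (Real.logb_le_logb_of_le (by norm_num) hZR h2).trans ?_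
      rw [Real.logb_mul (by positivity) hpos.ne', Real.logb_mul (by positivity) hJR.ne',
        Real.logb_mul (by positivity) hKR.ne', Real.logb_pow, logb_main _ _ ha1]
    have ha4 : (a : ℝ) ≤ (1 - q) * ((n : ℝ) ^ 2 / 2) := by
      have h2 : ((2 * k * a : ℕ) : ℝ) ≤ (((k - 1) * n ^ 2 : ℕ) : ℝ) := by exact_mod_cast ha2
      rw [Nat.cast_mul (k - 1), Nat.cast_sub hk0] at h2
      push_cast at h2
      have h3 : (1 - q) * ((n : ℝ) ^ 2 / 2) = ((k : ℝ) - 1) * (n : ℝ) ^ 2 / (2 * k) := by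
        rw [hq]; field_simp
      rw [h3, le_div_iff₀ (by positivity)]
      linarith
    have ha5 : (a : ℝ) * (1 - L) ≤ (1 - q) * (1 - L) * n.choose 2 + n / 2 := by
      have h2 := mul_le_mul_of_nonneg_right ha4 (sub_nonneg.2 hL1)
      have h3 : (1 - q) * (1 - L) ≤ 1 := by nlinarith
      have h4 : (1 - q) * (1 - L) * ((n : ℝ) / 2) ≤ 1 * (n / 2) := by gcongr
      rw [hN]
      nlinarith
    have h6 : n * A + B + n / 2 ≤ ε / 2 * (n : ℝ) ^ 2 := by
      have h7 : 2 * (A + B + 1) ≤ n * ε := hn₂.le.trans (by gcongr)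
      have h8 : 2 * (A + B + 1) * n ≤ n * ε * n := by gcongr
      nlinarith
    have h9 : ((1 - q) + q * L) * (n.choose 2 : ℝ) =
        n.choose 2 * L + (1 - q) * (1 - L) * n.choose 2 := by ring
    rw [h9]
    linarith
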